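/- arXiv:1603.07657 — 2 statements merged into one kernel-verified Lean document; each statement's English description precedes it below -/
import Mathlib

section
/- For all complex numbers s, t, z, z', w, w' with |st| < 1, the double series Σ_{m=0}^∞ Σ_{n=0}^∞ (s^m t^n / (m! n!)) L_{m,n}(z,z') L_{m,n}(w',w) converges absolutely and equals (1/(1 - st)) · exp((s z w' + t w z' - st(z z' + w w')) / (1 - st)). -/
open Finset

/-- The Laguerre 2D polynomials. -/
noncomputable def L2D (m n : ℕ) (z z' : ℂ) : ℂ :=
  ∑ j ∈ Finset.range (min m n + 1),
    (-1 : ℂ) ^ j * (Nat.factorial m : ℂ) * (Nat.factorial n : ℂ) /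
      ((Nat.factorial j : ℂ) * (Nat.factorial (m - j) : ℂ) * (Nat.factorial (n - j) : ℂ)) *
      z ^ (m - j) * z' ^ (n - j)

/-- The polynomials `∑ k, k! * choose m k * choose n k * ε ^ k * u ^ (m - k) * v ^ (n - k)`; for
`ε = -1` these are the Laguerre 2D polynomials. -/
noncomputable def twistedL2D (ε u v : ℂ) (m n : ℕ) : ℂ :=
  ∑ k ∈ range (m + 1),
    (k.factorial * m.choose k * n.choose k : ℕ) * ε ^ k * u ^ (m - k) * v ^ (n - k)

theorem twistedL2D_eq_sum_range (ε u v : ℂ) {m n N : ℕ} (h : min m n < N) :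
    twistedL2D ε u v m n = ∑ k ∈ range N,
      (k.factorial * m.choose k * n.choose k : ℕ) * ε ^ k * u ^ (m - k) * v ^ (n - k) := by
  have key : ∀ M, min m n < M → ∑ k ∈ range M,
      ((k.factorial * m.choose k * n.choose k : ℕ) : ℂ) * ε ^ k * u ^ (m - k) * v ^ (n - k) =
      ∑ k ∈ range (min m n + 1),
      ((k.factorial * m.choose k * n.choose k : ℕ) : ℂ) * ε ^ k * u ^ (m - k) * v ^ (n - k) := by
    intro M hM
    refine (sum_subset (range_mono hM) fun k _ hk => ?_).symm
    rw [mem_range, not_lt, Nat.succ_le_iff, min_lt_iff] at hk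
    rcases hk with hk | hk <;> simp [Nat.choose_eq_zero_of_lt hk]
  rw [twistedL2D, key _ (by omega), key _ h]

theorem twistedL2D_comm (ε u v : ℂ) (m n : ℕ) :
    twistedL2D ε u v m n = twistedL2D ε v u n m := by
  rw [twistedL2D, twistedL2D_eq_sum_range ε v u (N := m + 1) (by omega)]
  refine sum_congr rfl fun k _ => ?_
  push_cast
  ring

theorem twistedL2D_zero_left (ε u v : ℂ) (n : ℕ) : twistedL2D ε u v 0 n = v ^ n := by
  simp [twistedL2D]

theorem twistedL2D_succ_left (ε u v : ℂ) (m n : ℕ) :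
    twistedL2D ε u v (m + 1) n =
      u * twistedL2D ε u v m n + ε * n * twistedL2D ε u v m (n - 1) := by
  have h₁ : u * twistedL2D ε u v m n = ∑ k ∈ range (m + 1 + 1),
      ((k.factorial * m.choose k * n.choose k : ℕ) : ℂ) * ε ^ k * u ^ (m + 1 - k) *
        v ^ (n - k) := by
    rw [sum_range_succ, Nat.choose_succ_self, twistedL2D, mul_sum]
    simp only [mul_zero, zero_mul, Nat.cast_zero, add_zero]
    refine sum_congr rfl fun k hk => ?_
    rw [Nat.succ_sub (by simpa [Nat.lt_succ_iff] using hk), pow_succ]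
    ring
  rw [h₁, sum_range_succ', twistedL2D, sum_range_succ', add_right_comm, twistedL2D, mul_sum,
    ← sum_add_distrib]
  congr 1
  · refine sum_congr rfl fun k _ => ?_
    rcases n with _ | n
    · simp
    · have := Nat.add_one_mul_choose_eq n k
      have h : ((n : ℂ) + 1) * n.choose k = (n + 1).choose (k + 1) * (k + 1) := by
        exact_mod_cast this
      rw [Nat.choose_succ_succ m k, Nat.factorial_succ]
      simp only [Nat.add_sub_add_right, Nat.add_sub_cancel]
      push_cast
      linear_combination (-(k.factorial : ℂ) * m.choose k * ε ^ (k + 1) * u ^ (m - k) *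
        v ^ (n - k)) * h
  · simp

theorem hasSum_pow_div_factorial (x : ℂ) :
    HasSum (fun n : ℕ => x ^ n / n.factorial) (Complex.exp x) := by
  rw [Complex.exp_eq_exp_ℂ]
  exact NormedSpace.expSeries_div_hasSum_exp x

theorem hasSum_pow_mul_twistedL2D_right (ε u v y : ℂ) (m r : ℕ) :
    HasSum (fun b : ℕ => y ^ b / b.factorial * twistedL2D ε u v m (b + r))
      (Complex.exp (y * v) * twistedL2D ε (u + ε * y) v m r) := by
  induction m generalizing r with
  | zero =>
    simp only [twistedL2D_zero_left]
    refine ((hasSum_pow_div_factorial (y * v)).mul_right (v ^ r)).congr_fun fun b => ?_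
    ring
  | succ m ih =>
    have h₁ : HasSum (fun b : ℕ => b * (y ^ b / b.factorial) * twistedL2D ε u v m (b + r - 1))
        (y * (Complex.exp (y * v) * twistedL2D ε (u + ε * y) v m r)) := by
      rw [← hasSum_nat_add_iff' 1]
      simp only [range_one, sum_singleton, Nat.cast_zero, zero_mul, sub_zero]
      refine ((ih r).mul_left y).congr_fun fun b => ?_
      have hb : ((b + 1 : ℕ) : ℂ) ≠ 0 := Nat.cast_ne_zero.2 b.succ_ne_zero
      have hf : (b.factorial : ℂ) ≠ 0 := Nat.cast_ne_zero.2 b.factorial_ne_zero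
      rw [show b + 1 + r - 1 = b + r by omega, Nat.factorial_succ, Nat.cast_mul]
      field_simp
      ring
    have h₂ : HasSum (fun b : ℕ => r * (y ^ b / b.factorial * twistedL2D ε u v m (b + r - 1)))
        (r * (Complex.exp (y * v) * twistedL2D ε (u + ε * y) v m (r - 1))) := by
      rcases r with _ | r
      · simp
      · exact (ih r).mul_left _
    rw [twistedL2D_succ_left]
    have h := (((ih r).mul_left u).add ((h₁.add h₂).mul_left ε)).congr_fun
      (g := fun b => y ^ b / b.factorial * twistedL2D ε u v (m + 1) (b + r)) fun b => by
        rw [twistedL2D_succ_left]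
        push_cast
        ring
    rw [show Complex.exp (y * v) * ((u + ε * y) * twistedL2D ε (u + ε * y) v m r +
        ε * r * twistedL2D ε (u + ε * y) v m (r - 1)) =
      u * (Complex.exp (y * v) * twistedL2D ε (u + ε * y) v m r) +
        ε * (y * (Complex.exp (y * v) * twistedL2D ε (u + ε * y) v m r) +
          r * (Complex.exp (y * v) * twistedL2D ε (u + ε * y) v m (r - 1))) by ring]
    exact h

theorem hasSum_pow_mul_twistedL2D_left (ε u v x : ℂ) (p n : ℕ) :
    HasSum (fun a : ℕ => x ^ a / a.factorial * twistedL2D ε u v (a + p) n)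
      (Complex.exp (x * u) * twistedL2D ε u (v + ε * x) p n) := by
  simpa only [twistedL2D_comm ε _ _ n] using hasSum_pow_mul_twistedL2D_right ε v u x n p

theorem twistedL2D_norm (u v : ℂ) (m n : ℕ) :
    twistedL2D 1 ‖u‖ ‖v‖ m n = ((∑ k ∈ range (m + 1),
      (k.factorial * m.choose k * n.choose k : ℕ) * ‖u‖ ^ (m - k) * ‖v‖ ^ (n - k) : ℝ) : ℂ) := by
  simp [twistedL2D]

theorem norm_twistedL2D_norm (u v : ℂ) (m n : ℕ) :
    (‖twistedL2D 1 ‖u‖ ‖v‖ m n‖ : ℂ) = twistedL2D 1 ‖u‖ ‖v‖ m n := by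
  rw [twistedL2D_norm, Complex.norm_of_nonneg (sum_nonneg fun k _ => by positivity)]

theorem norm_twistedL2D_le {ε : ℂ} (hε : ‖ε‖ = 1) (u v : ℂ) (m n : ℕ) :
    ‖twistedL2D ε u v m n‖ ≤ ‖twistedL2D 1 ‖u‖ ‖v‖ m n‖ := by
  rw [twistedL2D_norm, Complex.norm_of_nonneg (sum_nonneg fun k _ => by positivity)]
  refine (norm_sum_le _ _).trans_eq (sum_congr rfl fun k _ => ?_)
  simp [hε]

theorem hasSum_twistedL2D (ε u v : ℂ) (m n : ℕ) :
    HasSum (fun k : ℕ =>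
      ((k.factorial * m.choose k * n.choose k : ℕ) : ℂ) * ε ^ k * u ^ (m - k) * v ^ (n - k))
      (twistedL2D ε u v m n) := by
  refine hasSum_sum_of_ne_finset_zero fun k hk => ?_
  rw [Nat.choose_eq_zero_of_lt (by simpa using hk : m < k)]
  simp

theorem hasSum_prod_of_norm_le {β γ : Type*} {f F : β × γ → ℂ} {g : β → ℂ} {a : ℂ}
    (hF : Summable F) (hfF : ∀ p, ‖f p‖ ≤ ‖F p‖) (h : ∀ b, HasSum (fun c => f (b, c)) (g b))
    (hg : HasSum g a) : HasSum f a := by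
  have hs : Summable f := hF.norm.of_norm_bounded hfF
  rw [← (hs.hasSum.prod_fiberwise h).unique hg]
  exact hs.hasSum

theorem hasSum_prod_of_norm_eq_self {β γ : Type*} {f : β × γ → ℂ} {g : β → ℂ} {a : ℂ}
    (hf : ∀ p, (‖f p‖ : ℂ) = f p) (h : ∀ b, HasSum (fun c => f (b, c)) (g b))
    (hg : HasSum g a) : HasSum f a := by
  have hgb : ∀ b, ((∑' c, ‖f (b, c)‖ : ℝ) : ℂ) = g b := fun b => by
    rw [Complex.ofReal_tsum, ← (h b).tsum_eq]
    exact tsum_congr fun c => hf (b, c)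
  have hs : Summable fun p => ‖f p‖ := by
    refine (summable_prod_of_nonneg fun p => norm_nonneg _).2 ⟨fun b => (h b).summable.norm, ?_⟩
    rw [← Complex.summable_ofReal]
    simpa only [hgb] using hg.summable
  exact hasSum_prod_of_norm_le hs.of_norm (fun p => le_rfl) h hg

theorem hasSum_pow_div_factorial_mul_one_div_pow (c q : ℂ) :
    HasSum (fun i : ℕ => c ^ i / i.factorial * (1 / (1 - q) ^ (i + 1)))
      (1 / (1 - q) * Complex.exp (c / (1 - q))) := by
  refine ((hasSum_pow_div_factorial (c / (1 - q))).mul_left _).congr_fun fun i => ?_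
  rw [div_pow, pow_succ]
  simp only [div_eq_mul_inv, mul_inv]
  ring

theorem hasSum_choose_mul_geometric_mul_left (c : ℂ) {q : ℂ} (hq : ‖q‖ < 1) (i : ℕ) :
    HasSum (fun k : ℕ => c ^ i / i.factorial * ((k + i).choose i * q ^ k))
      (c ^ i / i.factorial * (1 / (1 - q) ^ (i + 1))) :=
  (hasSum_choose_mul_geometric_of_norm_lt_one i hq).mul_left _

theorem hasSum_pow_div_factorial_mul_choose_mul_geometric (c : ℂ) {q : ℂ} (hq : ‖q‖ < 1) :
    HasSum (fun p : ℕ × ℕ => c ^ p.1 / p.1.factorial * ((p.2 + p.1).choose p.1 * q ^ p.2))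
      (1 / (1 - q) * Complex.exp (c / (1 - q))) := by
  have hq' : ‖(‖q‖ : ℂ)‖ < 1 := by simpa using hq
  have h := hasSum_prod_of_norm_eq_self (f := fun p : ℕ × ℕ =>
      (‖c‖ : ℂ) ^ p.1 / p.1.factorial * ((p.2 + p.1).choose p.1 * (‖q‖ : ℂ) ^ p.2))
    (fun p => by simp)
    (hasSum_choose_mul_geometric_mul_left _ hq')
    (hasSum_pow_div_factorial_mul_one_div_pow _ _)
  refine hasSum_prod_of_norm_le h.summable (fun p => ?_)
    (hasSum_choose_mul_geometric_mul_left _ hq)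
    (hasSum_pow_div_factorial_mul_one_div_pow c q)
  simp

/-- The generating function of the diagonal polynomials `twistedL2D ε u v j j`. -/
theorem hasSum_pow_mul_twistedL2D_diag {ε : ℂ} (hε : ε * ε = 1) (u v : ℂ) {q : ℂ}
    (hq : ‖q‖ < 1) :
    HasSum (fun j : ℕ => (ε * q) ^ j / j.factorial * twistedL2D ε u v j j)
      (1 / (1 - q) * Complex.exp (ε * q * u * v / (1 - q))) := by
  refine HasSum.prod_fiberwise (f := fun p : ℕ × ℕ => (ε * q) ^ p.1 / p.1.factorial *
    (((p.2.factorial * p.1.choose p.2 * p.1.choose p.2 : ℕ) : ℂ) * ε ^ p.2 * u ^ (p.1 - p.2) *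
      v ^ (p.1 - p.2))) ?_ fun j =>
        (hasSum_twistedL2D ε u v j j).mul_left ((ε * q) ^ j / (j.factorial : ℂ))
  have hinj : Function.Injective fun p : ℕ × ℕ => (p.2 + p.1, p.2) := by
    rintro ⟨a, b⟩ ⟨c, d⟩ h
    simp only [Prod.mk.injEq] at h ⊢
    omega
  rw [← hinj.hasSum_iff]
  · refine (hasSum_pow_div_factorial_mul_choose_mul_geometric _ hq).congr_fun ?_
    rintro ⟨i, k⟩
    have hc : ((k + i).choose k : ℂ) * k.factorial * i.factorial = (k + i).factorial := by
      have := Nat.choose_mul_factorial_mul_factorial (Nat.le_add_right k i)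
      rw [Nat.add_sub_cancel_left] at this
      exact_mod_cast this
    have hk : (k.factorial : ℂ) ≠ 0 := Nat.cast_ne_zero.2 k.factorial_ne_zero
    have hi : (i.factorial : ℂ) ≠ 0 := Nat.cast_ne_zero.2 i.factorial_ne_zero
    have hki : ((k + i).factorial : ℂ) ≠ 0 := Nat.cast_ne_zero.2 (k + i).factorial_ne_zero
    have hεk : ε ^ (k + i) * ε ^ k = ε ^ i := by
      rw [pow_add, mul_right_comm, ← mul_pow, hε, one_pow, one_mul]
    simp only [Function.comp_apply, Nat.add_sub_cancel_left, ← Nat.choose_symm_add (a := k)]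
    push_cast
    rw [div_mul_eq_mul_div, div_mul_eq_mul_div, div_eq_div_iff hki hi, ← hc]
    simp only [mul_pow]
    rw [← hεk]
    ring
  · rintro ⟨j, k⟩ h
    have hjk : j < k := by
      by_contra! hkj
      exact h ⟨(j - k, k), by simp [Nat.add_sub_cancel' hkj]⟩
    simp [Nat.choose_eq_zero_of_lt hjk]

/-- The successive summations over `b`, `a` and `j` of the family in `hasSum_triple_twistedL2D`. -/
theorem hasSum_iterated_twistedL2D {ε : ℂ} (hε : ε * ε = 1) (u v x y : ℂ) {q : ℂ}
    (hq : ‖q‖ < 1) :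
      (∀ j a : ℕ, HasSum (fun b : ℕ => x ^ a / a.factorial * (y ^ b / b.factorial *
          twistedL2D ε u v (a + j) (b + j)))
        (x ^ a / a.factorial *
          (Complex.exp (y * v) * twistedL2D ε (u + ε * y) v (a + j) j))) ∧
      (∀ j : ℕ, HasSum (fun a : ℕ => x ^ a / a.factorial *
          (Complex.exp (y * v) * twistedL2D ε (u + ε * y) v (a + j) j))
        (Complex.exp (y * v) * Complex.exp (x * (u + ε * y)) *
          twistedL2D ε (u + ε * y) (v + ε * x) j j)) ∧
      HasSum (fun j : ℕ => (ε * q) ^ j / j.factorial *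
          (Complex.exp (y * v) * Complex.exp (x * (u + ε * y)) *
            twistedL2D ε (u + ε * y) (v + ε * x) j j))
        (Complex.exp (y * v) * Complex.exp (x * (u + ε * y)) * (1 / (1 - q) *
          Complex.exp (ε * q * (u + ε * y) * (v + ε * x) / (1 - q)))) := by
  refine ⟨fun j a => (hasSum_pow_mul_twistedL2D_right ε u v y _ j).mul_left _, fun j => ?_, ?_⟩
  · rw [mul_assoc]
    exact ((hasSum_pow_mul_twistedL2D_left ε (u + ε * y) v x j j).mul_left _).congr_fun
      fun a => mul_left_comm _ _ _
  · exact ((hasSum_pow_mul_twistedL2D_diag hε (u + ε * y) (v + ε * x) hq).mul_left _).congr_fun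
      fun a => mul_left_comm _ _ _

theorem hasSum_triple_twistedL2D {ε : ℂ} (hε : ε * ε = 1) (u v x y : ℂ) {q : ℂ}
    (hq : ‖q‖ < 1) :
    HasSum (fun p : ℕ × ℕ × ℕ => (ε * q) ^ p.1 / p.1.factorial *
        (x ^ p.2.1 / p.2.1.factorial * (y ^ p.2.2 / p.2.2.factorial *
          twistedL2D ε u v (p.2.1 + p.1) (p.2.2 + p.1))))
      (Complex.exp (y * v) * Complex.exp (x * (u + ε * y)) * (1 / (1 - q) *
        Complex.exp (ε * q * (u + ε * y) * (v + ε * x) / (1 - q)))) := by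
  have hε' : ‖ε‖ = 1 := by
    have h := congrArg norm hε
    rw [norm_mul, norm_one] at h
    nlinarith [norm_nonneg ε]
  obtain ⟨r₁, r₂, r₃⟩ := hasSum_iterated_twistedL2D (one_mul 1) ‖u‖ ‖v‖ ‖x‖ ‖y‖
    (q := ‖q‖) (by simpa using hq)
  obtain ⟨h₁, h₂, h₃⟩ := hasSum_iterated_twistedL2D hε u v x y hq
  have r₄ := fun j => hasSum_prod_of_norm_eq_self
    (f := fun p : ℕ × ℕ => (‖x‖ : ℂ) ^ p.1 / p.1.factorial * ((‖y‖ : ℂ) ^ p.2 / p.2.factorial *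
      twistedL2D 1 ‖u‖ ‖v‖ (p.1 + j) (p.2 + j)))
    (fun p => by simp [norm_twistedL2D_norm]) (r₁ j) (r₂ j)
  have r₅ : ∀ j : ℕ, HasSum (fun p : ℕ × ℕ => (1 * (‖q‖ : ℂ)) ^ j / j.factorial *
      ((‖x‖ : ℂ) ^ p.1 / p.1.factorial * ((‖y‖ : ℂ) ^ p.2 / p.2.factorial *
        twistedL2D 1 ‖u‖ ‖v‖ (p.1 + j) (p.2 + j)))) _ := fun j => (r₄ j).mul_left _
  have r₆ := hasSum_prod_of_norm_eq_self
    (f := fun p : ℕ × ℕ × ℕ => (1 * (‖q‖ : ℂ)) ^ p.1 / p.1.factorial *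
        ((‖x‖ : ℂ) ^ p.2.1 / p.2.1.factorial * ((‖y‖ : ℂ) ^ p.2.2 / p.2.2.factorial *
          twistedL2D 1 ‖u‖ ‖v‖ (p.2.1 + p.1) (p.2.2 + p.1))))
    (fun p => by simp [norm_twistedL2D_norm]) r₅ r₃
  have h₄ := fun j => hasSum_prod_of_norm_le
    (f := fun p : ℕ × ℕ => x ^ p.1 / p.1.factorial * (y ^ p.2 / p.2.factorial *
      twistedL2D ε u v (p.1 + j) (p.2 + j)))
    (r₄ j).summable (fun p => by
      simp only [norm_mul, norm_div, norm_pow, Complex.norm_natCast, Complex.norm_real, norm_norm]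
      gcongr
      exact norm_twistedL2D_le hε' _ _ _ _) (h₁ j) (h₂ j)
  have h₅ : ∀ j : ℕ, HasSum (fun p : ℕ × ℕ => (ε * q) ^ j / j.factorial *
      (x ^ p.1 / p.1.factorial * (y ^ p.2 / p.2.factorial *
        twistedL2D ε u v (p.1 + j) (p.2 + j)))) _ := fun j => (h₄ j).mul_left _
  refine hasSum_prod_of_norm_le r₆.summable (fun p => ?_) h₅ h₃
  simp only [norm_mul, norm_div, norm_pow, Complex.norm_natCast, Complex.norm_real, norm_norm,
    hε', norm_one]
  gcongr
  exact norm_twistedL2D_le hε' _ _ _ _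

theorem hasSum_twistedL2D_mul_twistedL2D {ε : ℂ} (hε : ε * ε = 1) (z z' u v : ℂ) {s t : ℂ}
    (hst : ‖s * t‖ < 1) :
    HasSum (fun p : ℕ × ℕ => s ^ p.1 * t ^ p.2 / (p.1.factorial * p.2.factorial) *
        twistedL2D ε z z' p.1 p.2 * twistedL2D ε u v p.1 p.2)
      (1 / (1 - s * t) * Complex.exp
        ((s * z * u + t * v * z' + ε * (s * t) * (z * z' + u * v)) / (1 - s * t))) := by
  refine HasSum.prod_fiberwise (f := fun p : (ℕ × ℕ) × ℕ =>
    s ^ p.1.1 * t ^ p.1.2 / (p.1.1.factorial * p.1.2.factorial) *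
      (((p.2.factorial * p.1.1.choose p.2 * p.1.2.choose p.2 : ℕ) : ℂ) * ε ^ p.2 *
        z ^ (p.1.1 - p.2) * z' ^ (p.1.2 - p.2)) * twistedL2D ε u v p.1.1 p.1.2) ?_
    fun p => ((hasSum_twistedL2D ε z z' p.1 p.2).mul_left
      (s ^ p.1 * t ^ p.2 / ((p.1.factorial : ℂ) * p.2.factorial))).mul_right
        (twistedL2D ε u v p.1 p.2)
  have hinj : Function.Injective fun p : ℕ × ℕ × ℕ => ((p.2.1 + p.1, p.2.2 + p.1), p.1) := by
    rintro ⟨a, b, c⟩ ⟨a', b', c'⟩ h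
    simp only [Prod.mk.injEq] at h ⊢
    omega
  rw [← hinj.hasSum_iff]
  · have hq : 1 - s * t ≠ 0 := by
      intro h
      rw [← sub_eq_zero.1 h, norm_one] at hst
      exact lt_irrefl _ hst
    have h := hasSum_triple_twistedL2D hε u v (s * z) (t * z') hst
    rw [← Complex.exp_add, mul_left_comm (Complex.exp _), ← Complex.exp_add] at h
    have hexp : (s * z * u + t * v * z' + ε * (s * t) * (z * z' + u * v)) / (1 - s * t) =
        t * z' * v + s * z * (u + ε * (t * z')) +
          ε * (s * t) * (u + ε * (t * z')) * (v + ε * (s * z)) / (1 - s * t) := by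
      field_simp
      linear_combination (-(s * t) * (s * z * u + t * z' * v + ε * s * t * z * z')) * hε
    rw [hexp]
    refine h.congr_fun ?_
    rintro ⟨j, a, b⟩
    have hc : ∀ a : ℕ, ((a + j).choose j : ℂ) / (a + j).factorial =
        1 / (a.factorial * j.factorial) := by
      intro a
      have hc' : ((a + j).choose j : ℂ) * a.factorial * j.factorial = (a + j).factorial := by
        exact_mod_cast Nat.add_choose_mul_factorial_mul_factorial a j
      have ha : (a.factorial : ℂ) ≠ 0 := Nat.cast_ne_zero.2 a.factorial_ne_zero
      have hj : (j.factorial : ℂ) ≠ 0 := Nat.cast_ne_zero.2 j.factorial_ne_zero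
      have haj : ((a + j).factorial : ℂ) ≠ 0 := Nat.cast_ne_zero.2 (a + j).factorial_ne_zero
      rw [div_eq_div_iff haj (mul_ne_zero ha hj), one_mul, ← hc', mul_assoc]
    have hj : (j.factorial : ℂ) ≠ 0 := Nat.cast_ne_zero.2 j.factorial_ne_zero
    simp only [Function.comp_apply, Nat.add_sub_cancel]
    push_cast
    calc _ = s ^ (a + j) * t ^ (b + j) * j.factorial * (((a + j).choose j : ℂ) /
            (a + j).factorial) * (((b + j).choose j : ℂ) / (b + j).factorial) *
            (ε ^ j * z ^ a * z' ^ b) * twistedL2D ε u v (a + j) (b + j) := by ring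
      _ = _ := by
        rw [hc, hc]
        field_simp
        ring
  · rintro ⟨⟨m, n⟩, k⟩ h
    have hmn : m < k ∨ n < k := by
      by_contra! hk
      exact h ⟨(k, m - k, n - k), by simp [Nat.sub_add_cancel hk.1, Nat.sub_add_cancel hk.2]⟩
    rcases hmn with hk | hk <;> simp [Nat.choose_eq_zero_of_lt hk]

theorem L2D_eq_twistedL2D (m n : ℕ) (z z' : ℂ) : L2D m n z z' = twistedL2D (-1) z z' m n := by
  rw [L2D, twistedL2D_eq_sum_range _ _ _ (Nat.lt_succ_self (min m n))]
  refine sum_congr rfl fun k hk => ?_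
  have hk' : k ≤ m ∧ k ≤ n := by simpa [Nat.lt_succ_iff] using hk
  have hk₀ : (k.factorial : ℂ) ≠ 0 := Nat.cast_ne_zero.2 k.factorial_ne_zero
  rw [← Nat.choose_mul_factorial_mul_factorial hk'.1,
    ← Nat.choose_mul_factorial_mul_factorial hk'.2]
  have hm : ((m - k).factorial : ℂ) ≠ 0 := Nat.cast_ne_zero.2 (m - k).factorial_ne_zero
  have hn : ((n - k).factorial : ℂ) ≠ 0 := Nat.cast_ne_zero.2 (n - k).factorial_ne_zero
  push_cast
  field_simp

theorem L2D_bilinear_generating_function (s t z z' w w' : ℂ) (hst : ‖s * t‖ < 1) :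
    Summable (fun p : ℕ × ℕ =>
      ‖s ^ p.1 * t ^ p.2 / ((Nat.factorial p.1 : ℂ) * (Nat.factorial p.2 : ℂ)) *
        L2D p.1 p.2 z z' * L2D p.1 p.2 w' w‖) ∧
    ∑' p : ℕ × ℕ,
      s ^ p.1 * t ^ p.2 / ((Nat.factorial p.1 : ℂ) * (Nat.factorial p.2 : ℂ)) *
        L2D p.1 p.2 z z' * L2D p.1 p.2 w' w =
      (1 / (1 - s * t)) * Complex.exp
        ((s * z * w' + t * w * z' - s * t * (z * z' + w * w')) / (1 - s * t)) := by
  have h := hasSum_twistedL2D_mul_twistedL2D (ε := (-1 : ℂ)) (by norm_num) z z' w' w hst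
  simp only [L2D_eq_twistedL2D]
  refine ⟨h.summable.norm, h.tsum_eq.trans ?_⟩
  congr 3
  ring
end

section
/- For all nonnegative integers m, n, every nonzero complex number t, and all complex numbers z, z', the series Σ_{k=0}^∞ ((-t)^k / k!) L_{m,k}(z,z') L_{k,n}(z,z') converges absolutely and equals exp(-t z z') · t^n · L_{m,n}((1+t) z, (1+t) z'/t). -/
open Finset

theorem L2D_eq_sum_choose (m n N : ℕ) (hN : min m n < N) (z z' : ℂ) :
    L2D m n z z' = ∑ j ∈ Finset.range N,
      (-1 : ℂ) ^ j * (Nat.factorial j : ℂ) * (m.choose j : ℂ) * (n.choose j : ℂ) *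
        z ^ (m - j) * z' ^ (n - j) := by
  have h_sub : Finset.range (min m n + 1) ⊆ Finset.range N := by
    intro j hj
    simp only [Finset.mem_range] at hj ⊢
    omega
  rw [← Finset.sum_subset h_sub]
  · refine Finset.sum_congr rfl fun j hj => ?_
    have hj' := Finset.mem_range.mp hj
    rw [Nat.cast_choose ℂ (show j ≤ m by omega), Nat.cast_choose ℂ (show j ≤ n by omega)]
    have h1 : (Nat.factorial j : ℂ) ≠ 0 := by exact_mod_cast j.factorial_ne_zero
    have h2 : (Nat.factorial (m - j) : ℂ) ≠ 0 := by exact_mod_cast (m - j).factorial_ne_zero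
    have h3 : (Nat.factorial (n - j) : ℂ) ≠ 0 := by exact_mod_cast (n - j).factorial_ne_zero
    field_simp
  · intro j _ hj
    rw [Finset.mem_range, not_lt] at hj
    rcases lt_or_ge m j with h | h
    · simp [Nat.choose_eq_zero_of_lt h]
    · simp [Nat.choose_eq_zero_of_lt (show n < j by omega)]

theorem L2D_swap (m n : ℕ) (z z' : ℂ) : L2D m n z z' = L2D n m z' z := by
  rw [L2D_eq_sum_choose m n (min m n + 1) (by omega),
    L2D_eq_sum_choose n m (min m n + 1) (by omega)]
  exact Finset.sum_congr rfl fun j _ => by ring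

theorem L2D_zero_left (n : ℕ) (z z' : ℂ) : L2D 0 n z z' = z' ^ n := by
  simp [L2D_eq_sum_choose 0 n 1 (by omega)]

theorem L2D_succ_left (m n : ℕ) (z z' : ℂ) :
    L2D (m + 1) n z z' = z * L2D m n z z' - n * L2D m (n - 1) z z' := by
  rw [L2D_eq_sum_choose (m + 1) n (m + 2) (by omega), L2D_eq_sum_choose m n (m + 2) (by omega),
    L2D_eq_sum_choose m (n - 1) (m + 1) (by omega), Finset.sum_range_succ' _ (m + 1),
    Finset.sum_range_succ' _ (m + 1), mul_add, Finset.mul_sum, Finset.mul_sum,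
    add_sub_right_comm, ← Finset.sum_sub_distrib]
  congr 1
  · refine Finset.sum_congr rfl fun j hj => ?_
    have h_absorb : ((j : ℂ) + 1) * (n.choose (j + 1) : ℂ) = n * ((n - 1).choose j : ℂ) := by
      cases n with
      | zero => simp
      | succ n =>
        have := Nat.add_one_mul_choose_eq n j
        push_cast [mul_comm] at this ⊢
        exact_mod_cast this.symm
    have h_pow : (m.choose (j + 1) : ℂ) * z ^ (m - j) =
        z * ((m.choose (j + 1) : ℂ) * z ^ (m - (j + 1))) := by
      rcases Nat.lt_or_ge j m with h | h
      · rw [show m - j = m - (j + 1) + 1 by omega, pow_succ]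
        ring
      · simp [Nat.choose_eq_zero_of_lt (show m < j + 1 by omega)]
    rw [Nat.choose_succ_succ, Nat.factorial_succ, Nat.add_sub_add_right,
      show n - 1 - j = n - (j + 1) by omega]
    push_cast
    linear_combination
      (-1 : ℂ) ^ (j + 1) * (j + 1) * (j.factorial : ℂ) * (n.choose (j + 1) : ℂ) *
        z' ^ (n - (j + 1)) * h_pow -
      (-1 : ℂ) ^ j * (j.factorial : ℂ) * (m.choose j : ℂ) * z ^ (m - j) *
        z' ^ (n - (j + 1)) * h_absorb
  · simp [pow_succ]
    ring

theorem L2D_succ_right (m n : ℕ) (z z' : ℂ) :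
    L2D m (n + 1) z z' = z' * L2D m n z z' - m * L2D (m - 1) n z z' := by
  rw [L2D_swap, L2D_succ_left, L2D_swap n m, L2D_swap n (m - 1)]

/-- The factor `k` lowers the exponential weight `x ^ k / k!` by one step. -/
theorem hasSum_pow_div_factorial_mul_natCast {x a : ℂ} {g : ℕ → ℂ}
    (h : HasSum (fun k : ℕ => x ^ k / (Nat.factorial k : ℂ) * g (k + 1)) a) :
    HasSum (fun k : ℕ => x ^ k / (Nat.factorial k : ℂ) * (k * g k)) (x * a) := by
  rw [← hasSum_nat_add_iff' 1]
  simp only [Finset.sum_range_one, Nat.cast_zero, zero_mul, mul_zero, sub_zero]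
  convert! h.mul_left x using 2 with k
  have h1 : (Nat.factorial k : ℂ) ≠ 0 := by exact_mod_cast k.factorial_ne_zero
  have h2 : (k : ℂ) + 1 ≠ 0 := by exact_mod_cast k.succ_ne_zero
  rw [Nat.factorial_succ]
  push_cast
  field_simp
  ring

theorem hasSum_L2D_mul_L2D (m n : ℕ) (t : ℂ) (ht : t ≠ 0) (z z' : ℂ) :
    HasSum (fun k : ℕ => (-t) ^ k / (Nat.factorial k : ℂ) * (L2D m k z z' * L2D k n z z'))
      (Complex.exp (-t * z * z') * t ^ n * L2D m n ((1 + t) * z) ((1 + t) * z' / t)) := by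
  induction m generalizing n with
  | zero =>
    simp only [L2D_zero_left]
    induction n with
    | zero =>
      have h := NormedSpace.expSeries_div_hasSum_exp (-t * z * z')
      rw [← Complex.exp_eq_exp_ℂ] at h
      simp only [pow_zero, mul_one]
      convert! h using 2 with k
      rw [L2D_swap, L2D_zero_left]
      ring
    | succ n ih =>
      have h := hasSum_pow_div_factorial_mul_natCast (x := -t)
        (g := fun k => z' ^ k * L2D (k - 1) n z z')
        (a := z' * (Complex.exp (-t * z * z') * t ^ n * ((1 + t) * z' / t) ^ n)) (by
          convert! ih.mul_left z' using 2 with k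
          rw [Nat.add_sub_cancel]
          ring)
      convert! (ih.mul_left z').sub h using 1
      · funext k
        rw [L2D_succ_right]
        ring
      · have h_cancel : t * ((1 + t) * z' / t) = (1 + t) * z' := by field_simp
        generalize (1 + t) * z' / t = w at h_cancel ⊢
        linear_combination Complex.exp (-t * z * z') * t ^ n * w ^ n * h_cancel
  | succ m ih =>
    have h := hasSum_pow_div_factorial_mul_natCast (x := -t)
      (g := fun k => L2D m (k - 1) z z' * L2D k n z z')
      (a := z * (Complex.exp (-t * z * z') * t ^ n *
          L2D m n ((1 + t) * z) ((1 + t) * z' / t)) -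
        n * (Complex.exp (-t * z * z') * t ^ (n - 1) *
          L2D m (n - 1) ((1 + t) * z) ((1 + t) * z' / t))) (by
        convert! ((ih n).mul_left z).sub ((ih (n - 1)).mul_left (n : ℂ)) using 1
        funext k
        rw [L2D_succ_left k, Nat.add_sub_cancel]
        ring)
    convert! ((ih n).mul_left z).sub h using 1
    · funext k
      rw [L2D_succ_left]
      ring
    · rw [L2D_succ_left]
      cases n with
      | zero => simp; ring
      | succ n =>
        rw [Nat.add_sub_cancel]
        ring

theorem L2D_product_sum_equal_arguments (m n : ℕ) (t : ℂ) (ht : t ≠ 0) (z z' : ℂ) :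
    Summable (fun k : ℕ =>
      ‖(-t) ^ k / (Nat.factorial k : ℂ) * L2D m k z z' * L2D k n z z'‖) ∧
    ∑' k : ℕ, (-t) ^ k / (Nat.factorial k : ℂ) * L2D m k z z' * L2D k n z z' =
      Complex.exp (-t * z * z') * t ^ n * L2D m n ((1 + t) * z) ((1 + t) * z' / t) := by
  have h := hasSum_L2D_mul_L2D m n t ht z z'
  simp only [← mul_assoc] at h ⊢
  exact ⟨summable_norm_iff.mpr h.summable, h.tsum_eq⟩
end
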